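/- In the single-investor allocation problem (N = {ι}, O = {0,1}, all allocations feasible, states S = {s_i : i ∈ I₀} for a finite set I₀ with |I₀| ≥ 2, investments I = {(1_{s_i}, 0) : i ∈ I₀}, x the optimal allocation algorithm that always allocates the investor, payment identically 0), for every β > 1/|I₀| the algorithm x is NOT a β-approximation for strongly dynamic investment: there exist a horizon T, a dynamic investment instance ω̃^T from the family with point-mass state distributions g^(t) = δ_{s_{j_t}}, and an online learning algorithm ℒ whose regret on every such instance is at most 2√(e−1)·√(T|I₀| ln|I₀|), such that W̃_x(ω̃^T,ℒ) < β·W̃*_dyn(ω̃^T) − Reg(ω̃^T,ℒ). -/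

import Mathlib

open Finset

section InvestmentFramework

variable {N O S ix : Type} [Fintype N] [Fintype O] [Fintype S] [DecidableEq N]

/-- The welfare `Σ_n v_n · a_n` of an allocation `a : N → O` under value profile `v`,
where each outcome is identified with its indicator vector in `ℝ^O`. -/
def allocWelfare {N O : Type} [Fintype N] (v : N → O → ℝ) (a : N → O) : ℝ :=
  ∑ n, v n (a n)

/-- The optimal welfare `W*(v,A) = max_{a ∈ A} Σ_n v_n · a_n` of an allocation instance. -/
noncomputable def Wstar {N O : Type} [Fintype N] (v : N → O → ℝ) (A : Set (N → O)) : ℝ :=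
  sSup ((fun a => allocWelfare v a) '' A)

/-- `Ω` is an allocation problem: every allocation instance `(v,A) ∈ Ω` has a
nonnegative value profile and a nonempty feasible set. -/
def IsAllocProblem {N O : Type} (Ω : Set ((N → O → ℝ) × Set (N → O))) : Prop :=
  ∀ vA ∈ Ω, (∀ n o, 0 ≤ vA.1 n o) ∧ vA.2.Nonempty

/-- `x` is an allocation algorithm for `Ω`: it maps every instance of `Ω` to a
feasible allocation. -/
def IsAllocAlg {N O : Type} (Ω : Set ((N → O → ℝ) × Set (N → O)))
    (x : (N → O → ℝ) → Set (N → O) → (N → O)) : Prop :=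
  ∀ v A, (v, A) ∈ Ω → x v A ∈ A

/-- The welfare `W_x(v,A)` of the allocation chosen by algorithm `x`. -/
def WelfareOf {N O : Type} [Fintype N] (x : (N → O → ℝ) → Set (N → O) → (N → O))
    (v : N → O → ℝ) (A : Set (N → O)) : ℝ :=
  allocWelfare v (x v A)

/-- Product value structure: the value profiles of `Ω` range over the product set
`∏_{n,o} V n o`; in particular every instance has values in `V` and unilateral
replacement of one bidder's value by any admissible value stays in `Ω`. -/
def ProductStructure (Ω : Set ((N → O → ℝ) × Set (N → O))) (V : N → O → Set ℝ) : Prop :=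
  (∀ v A, (v, A) ∈ Ω → ∀ n o, v n o ∈ V n o) ∧
  (∀ v A n (w : O → ℝ), (v, A) ∈ Ω → (∀ o, w o ∈ V n o) →
    (Function.update v n w, A) ∈ Ω)

/-- Truthfulness of the mechanism `(x, p)`: no bidder can gain by misreporting an
admissible value. -/
def Truthful (Ω : Set ((N → O → ℝ) × Set (N → O))) (V : N → O → Set ℝ)
    (x : (N → O → ℝ) → Set (N → O) → (N → O))
    (p : (N → O → ℝ) → Set (N → O) → N → ℝ) : Prop :=
  ∀ v A n (w : O → ℝ), (v, A) ∈ Ω → (∀ o, w o ∈ V n o) →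
    v n (x v A n) - p v A n ≥
      v n (x (Function.update v n w) A n) - p (Function.update v n w) A n

/-- Weak monotonicity: `(v'_n − v_n) · (x_n(v'_n,v_{−n},A) − x_n(v,A)) ≥ 0`
(outcomes identified with indicator vectors). -/
def WeaklyMonotone (Ω : Set ((N → O → ℝ) × Set (N → O))) (V : N → O → Set ℝ)
    (x : (N → O → ℝ) → Set (N → O) → (N → O)) : Prop :=
  ∀ v A n (w : O → ℝ), (v, A) ∈ Ω → (∀ o, w o ∈ V n o) →
    (w (x (Function.update v n w) A n) - v n (x (Function.update v n w) A n)) -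
      (w (x v A n) - v n (x v A n)) ≥ 0

/-- A change from value `vn` to `w` confirms outcome `o'` if
`(w − vn)·(o' − o) ≥ 0` for every outcome `o`. -/
def Confirms {O : Type} (vn w : O → ℝ) (o' : O) : Prop :=
  ∀ o : O, (w o' - vn o') - (w o - vn o) ≥ 0

/-- `x` excludes confirming negative externalities (XCONE). -/
def XCONE (Ω : Set ((N → O → ℝ) × Set (N → O))) (V : N → O → Set ℝ)
    (x : (N → O → ℝ) → Set (N → O) → (N → O)) : Prop :=
  ∀ v A n (w : O → ℝ), (v, A) ∈ Ω → (∀ o, w o ∈ V n o) →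
    Confirms (v n) w (x v A n) →
    0 ≤ ∑ m, (v m (x (Function.update v n w) A m) - v m (x v A m))

/-- `x` is a β-approximation for allocation. -/
def ApproxAlloc {N O : Type} [Fintype N] (β : ℝ) (Ω : Set ((N → O → ℝ) × Set (N → O)))
    (x : (N → O → ℝ) → Set (N → O) → (N → O)) : Prop :=
  ∀ v A, (v, A) ∈ Ω → WelfareOf x v A ≥ β * Wstar v A

/-- A static investment instance `ω̄ = (g, I, ν_{−ι}, 𝒜)`: a state distribution `g`,
a finite set of investments indexed by `ix` (each an investment value map together
with a cost), the other bidders' values, and the feasible allocation sets. -/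
structure StaticInstance (N O S ix : Type) where
  /-- state distribution -/
  g : S → ℝ
  /-- the investments `(ν_ι, c)` -/
  inv : ix → (S → O → ℝ) × ℝ
  /-- the other bidders' values (the coordinate at the investor is overridden) -/
  vother : S → N → O → ℝ
  /-- feasible allocation sets -/
  feas : S → Set (N → O)

/-- The full reported value profile `ν(s)` when investor `ι` chooses investment `i`. -/
def profOf (ι : N) (w : StaticInstance N O S ix) (i : ix) (s : S) : N → O → ℝ :=
  Function.update (w.vother s) ι ((w.inv i).1 s)

/-- Validity of a static investment instance: `g` is a probability distribution on `S`
and every induced allocation instance belongs to `Ω`. -/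
def StaticValid (Ω : Set ((N → O → ℝ) × Set (N → O))) (ι : N)
    (w : StaticInstance N O S ix) : Prop :=
  (∀ s, 0 ≤ w.g s) ∧ (∑ s, w.g s = 1) ∧
  (∀ (i : ix) (s : S), (profOf ι w i s, w.feas s) ∈ Ω)

/-- The investor's utility `u(ω̄,s,ν_ι,c)` at state `s` under investment `i`. -/
def utilAt (x : (N → O → ℝ) → Set (N → O) → (N → O))
    (p : (N → O → ℝ) → Set (N → O) → N → ℝ)
    (ι : N) (w : StaticInstance N O S ix) (i : ix) (s : S) : ℝ :=
  (w.inv i).1 s (x (profOf ι w i s) (w.feas s) ι) -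
    p (profOf ι w i s) (w.feas s) ι - (w.inv i).2

/-- The welfare `W̄_x(ω̄,s,ν_ι,c)` achieved by algorithm `x` at state `s`. -/
def welAt (x : (N → O → ℝ) → Set (N → O) → (N → O))
    (ι : N) (w : StaticInstance N O S ix) (i : ix) (s : S) : ℝ :=
  WelfareOf x (profOf ι w i s) (w.feas s) - (w.inv i).2

/-- The optimal welfare `W̄*(ω̄,s,ν_ι,c)` at state `s`. -/
noncomputable def welOptAt (ι : N) (w : StaticInstance N O S ix) (i : ix) (s : S) : ℝ :=
  Wstar (profOf ι w i s) (w.feas s) - (w.inv i).2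

/-- The expected utility `u(ω̄,ν_ι,c)` of the investor. -/
def expUtil (x : (N → O → ℝ) → Set (N → O) → (N → O))
    (p : (N → O → ℝ) → Set (N → O) → N → ℝ)
    (ι : N) (w : StaticInstance N O S ix) (i : ix) : ℝ :=
  ∑ s, w.g s * utilAt x p ι w i s

/-- The expected welfare `W̄_x(ω̄,ν_ι,c)` of algorithm `x`. -/
def expWel (x : (N → O → ℝ) → Set (N → O) → (N → O))
    (ι : N) (w : StaticInstance N O S ix) (i : ix) : ℝ :=
  ∑ s, w.g s * welAt x ι w i s

/-- The expected optimal welfare `W̄*(ω̄,ν_ι,c)`. -/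
noncomputable def expWelOpt (ι : N) (w : StaticInstance N O S ix) (i : ix) : ℝ :=
  ∑ s, w.g s * welOptAt ι w i s

/-- The set `BR(ω̄)` of best-response investments. -/
def BRset (x : (N → O → ℝ) → Set (N → O) → (N → O))
    (p : (N → O → ℝ) → Set (N → O) → N → ℝ)
    (ι : N) (w : StaticInstance N O S ix) : Set ix :=
  {i | ∀ j, expUtil x p ι w j ≤ expUtil x p ι w i}

/-- `x` is a β-approximation for static investment:
`min_{BR(ω̄)} W̄_x(ω̄,·) ≥ β · max_{I} W̄*(ω̄,·)` for every static investment instance. -/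
def ApproxStaticInv (β : ℝ) (Ω : Set ((N → O → ℝ) × Set (N → O))) (ι : N)
    (x : (N → O → ℝ) → Set (N → O) → (N → O))
    (p : (N → O → ℝ) → Set (N → O) → N → ℝ) : Prop :=
  ∀ (jx : Type) [Fintype jx] [Nonempty jx] (w : StaticInstance N O S jx),
    StaticValid Ω ι w →
    ∀ i ∈ BRset x p ι w,
      expWel x ι w i ≥
        β * (Finset.univ.sup' Finset.univ_nonempty fun j => expWelOpt ι w j)

/-- A dynamic investment instance `ω̃^T`: a horizon `T`, a common investment set
(indexed by `ix`), and for each round a state distribution, the other bidders'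
values, and the feasible allocation sets. -/
structure DynInstance (N O S ix : Type) where
  /-- number of rounds -/
  T : ℕ
  /-- the common set of investments -/
  inv : ix → (S → O → ℝ) × ℝ
  /-- per-round state distributions -/
  g : Fin T → S → ℝ
  /-- per-round values of the other bidders -/
  vother : Fin T → S → N → O → ℝ
  /-- per-round feasible allocation sets -/
  feas : Fin T → S → Set (N → O)

/-- The static investment instance `ω̄^(t)` of round `t`. -/
def DynInstance.round {N O S ix : Type} (D : DynInstance N O S ix) (t : Fin D.T) :
    StaticInstance N O S ix :=
  ⟨D.g t, D.inv, D.vother t, D.feas t⟩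

/-- Validity of a dynamic investment instance w.r.t. `Ω`. -/
def DynValid (Ω : Set ((N → O → ℝ) × Set (N → O))) (ι : N)
    (D : DynInstance N O S ix) : Prop :=
  ∀ t : Fin D.T, StaticValid Ω ι (D.round t)

/-- An online learning algorithm: given the history of (chosen investment, realized
utility) pairs of the previous rounds — i.e. it only uses bandit feedback and its
own internal randomness — it outputs a probability distribution over investments. -/
def IsLearningAlg {ix : Type} [Fintype ix] (L : List (ix × ℝ) → ix → ℝ) : Prop :=
  ∀ h : List (ix × ℝ), (∀ i, 0 ≤ L h i) ∧ (∑ i, L h i = 1)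

variable [Fintype ix]

/-- Expectation, over the trajectory of the interaction (states drawn from the
per-round distributions, investments drawn from the learning algorithm applied to
the realized utility history), of a function `F` of the trajectory. -/
noncomputable def trajExp (x : (N → O → ℝ) → Set (N → O) → (N → O))
    (p : (N → O → ℝ) → Set (N → O) → N → ℝ) (ι : N) (D : DynInstance N O S ix)
    (L : List (ix × ℝ) → ix → ℝ) :
    List (Fin D.T) → List (ix × ℝ) → (List (ix × S) → ℝ) → ℝ
  | [], _, F => F []
  | t :: ts, h, F =>
      ∑ i, ∑ s, L h i * D.g t s *
        trajExp x p ι D L ts (h ++ [(i, utilAt x p ι (D.round t) i s)])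
          (fun tr => F ((i, s) :: tr))

/-- The expected welfare `W̃_x(ω̃^T, ℒ)` of algorithm `x` when the investor uses the
online learning algorithm `L`. -/
noncomputable def dynWelfare (x : (N → O → ℝ) → Set (N → O) → (N → O))
    (p : (N → O → ℝ) → Set (N → O) → N → ℝ) (ι : N) (D : DynInstance N O S ix)
    (L : List (ix × ℝ) → ix → ℝ) : ℝ :=
  trajExp x p ι D L (List.finRange D.T) []
    (fun tr => (List.zipWith (fun t (q : ix × S) => welAt x ι (D.round t) q.1 q.2)
        (List.finRange D.T) tr).sum)

variable [Nonempty ix]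

/-- The expected regret `Reg(ω̃^T, ℒ)` of the online learning algorithm `L`. -/
noncomputable def dynRegret (x : (N → O → ℝ) → Set (N → O) → (N → O))
    (p : (N → O → ℝ) → Set (N → O) → N → ℝ) (ι : N) (D : DynInstance N O S ix)
    (L : List (ix × ℝ) → ix → ℝ) : ℝ :=
  trajExp x p ι D L (List.finRange D.T) []
    (fun tr =>
      (Finset.univ.sup' Finset.univ_nonempty fun i : ix =>
          (List.zipWith (fun t (q : ix × S) => utilAt x p ι (D.round t) i q.2)
            (List.finRange D.T) tr).sum) -
        (List.zipWith (fun t (q : ix × S) => utilAt x p ι (D.round t) q.1 q.2)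
          (List.finRange D.T) tr).sum)

/-- The optimal expected welfare `W̃*(ω̃^T) = max_{(ν_ι,c) ∈ I} Σ_t W̄*(ω̄^(t),ν_ι,c)`
(best-in-hindsight fixed investment benchmark). -/
noncomputable def dynOptWelfare (ι : N) (D : DynInstance N O S ix) : ℝ :=
  Finset.univ.sup' Finset.univ_nonempty fun i : ix => ∑ t, expWelOpt ι (D.round t) i

/-- The strongly dynamic welfare `W̃*_dyn(ω̃^T) = Σ_t max_{(ν_ι,c) ∈ I} W̄*(ω̄^(t),ν_ι,c)`
(time-varying benchmark). -/
noncomputable def strongDynOptWelfare (ι : N) (D : DynInstance N O S ix) : ℝ :=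
  ∑ t, Finset.univ.sup' Finset.univ_nonempty fun i : ix => expWelOpt ι (D.round t) i

/-- `x` is a β-approximation for dynamic investment:
`W̃_x(ω̃^T,ℒ) ≥ β·W̃*(ω̃^T) − Reg(ω̃^T,ℒ)` for every dynamic investment instance and
every online learning algorithm. -/
def ApproxDynInv (β : ℝ) (Ω : Set ((N → O → ℝ) × Set (N → O))) (ι : N)
    (x : (N → O → ℝ) → Set (N → O) → (N → O))
    (p : (N → O → ℝ) → Set (N → O) → N → ℝ) : Prop :=
  ∀ (jx : Type) [Fintype jx] [Nonempty jx] (D : DynInstance N O S jx),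
    DynValid Ω ι D → ∀ L : List (jx × ℝ) → jx → ℝ, IsLearningAlg L →
      dynWelfare x p ι D L ≥ β * dynOptWelfare ι D - dynRegret x p ι D L

end InvestmentFramework

section SingleInvestor

variable (I₀ : Type) [DecidableEq I₀]

/-- The optimal allocation algorithm in the single-investor problem with outcomes
`{0,1} = Bool` and all allocations feasible: it always allocates (outcome `true`)
to the investor, hence `W_x = W*`. -/
def optAllocAlg : (Unit → Bool → ℝ) → Set (Unit → Bool) → (Unit → Bool) :=
  fun _ _ _ => true

/-- The all-zero payment rule. -/
def zeroPay : (Unit → Bool → ℝ) → Set (Unit → Bool) → Unit → ℝ :=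
  fun _ _ _ => 0

/-- The dynamic investment instance `ω̃_j^T` of the single-investor problem:
states `S = I₀`, investments `I = {(1_{s_i}, 0) : i ∈ I₀}` (value `1` for being
allocated at state `s_i`, zero elsewhere, zero cost), every allocation feasible,
and the round-`t` state distribution being the point mass at `s_{j_t}`. -/
def pointInst (T : ℕ) (j : Fin T → I₀) : DynInstance Unit Bool I₀ I₀ where
  T := T
  inv := fun i => (fun s o => if s = i ∧ o = true then 1 else 0, 0)
  g := fun t s => if s = j t then 1 else 0
  vother := fun _ _ _ _ => 0
  feas := fun _ _ => Set.univ

end SingleInvestor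

section TrajectoryExpectation

variable {N O S ix : Type} [Fintype S] [DecidableEq N] [Fintype ix]

/-- The trajectory expectation is additive. -/
theorem trajExp_add (x : (N → O → ℝ) → Set (N → O) → (N → O))
    (p : (N → O → ℝ) → Set (N → O) → N → ℝ) (ι : N) (D : DynInstance N O S ix)
    (L : List (ix × ℝ) → ix → ℝ) (ts : List (Fin D.T)) (h : List (ix × ℝ))
    (F G : List (ix × S) → ℝ) :
    trajExp x p ι D L ts h (fun tr => F tr + G tr) =
      trajExp x p ι D L ts h F + trajExp x p ι D L ts h G := by
  induction ts generalizing h F G with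
  | nil => rfl
  | cons t ts ih => simp only [trajExp, ih, mul_add, Finset.sum_add_distrib]

end TrajectoryExpectation

theorem sum_zipWith_eq_sum_of_map_snd_eq {α S : Type} {T : ℕ} {j : Fin T → S}
    {tr : List (α × S)} (htr : tr.map Prod.snd = (List.finRange T).map j)
    (f : Fin T → S → ℝ) :
    (List.zipWith (fun t (q : α × S) => f t q.2) (List.finRange T) tr).sum =
      ∑ t, f t (j t) := by
  have hzip : List.zipWith (fun t (q : α × S) => f t q.2) (List.finRange T) tr =
      List.zipWith f (List.finRange T) (tr.map Prod.snd) := by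
    rw [List.zipWith_map_right]
  rw [hzip, htr, List.zipWith_map_right, List.zipWith_self, Fin.sum_univ_def]

theorem sum_zipWith_nonneg {α γ : Type} {f : α → γ → ℝ} (hf : ∀ a b, 0 ≤ f a b)
    (l : List α) (m : List γ) : 0 ≤ (List.zipWith f l m).sum := by
  induction l generalizing m with
  | nil => simp
  | cons a l ih =>
    cases m with
    | nil => simp
    | cons b m => simpa using add_nonneg (hf a b) (ih m)

section PointInstance

variable {I₀ : Type} [DecidableEq I₀]

theorem utilAt_pointInst {T : ℕ} (j : Fin T → I₀) (t : Fin T) (i s : I₀) :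
    utilAt optAllocAlg zeroPay () ((pointInst I₀ T j).round t) i s =
      if s = i then 1 else 0 := by
  simp [utilAt, optAllocAlg, zeroPay, pointInst, DynInstance.round]

theorem welAt_pointInst {T : ℕ} (j : Fin T → I₀) (t : Fin T) (i s : I₀) :
    welAt optAllocAlg () ((pointInst I₀ T j).round t) i s = if s = i then 1 else 0 := by
  simp [welAt, WelfareOf, allocWelfare, profOf, optAllocAlg, pointInst, DynInstance.round]

theorem sum_zipWith_utilAt_pointInst {T : ℕ} (j : Fin T → I₀) {tr : List (I₀ × I₀)}
    (htr : tr.map Prod.snd = (List.finRange T).map j) (i : I₀) :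
    (List.zipWith (fun t (q : I₀ × I₀) =>
        utilAt optAllocAlg zeroPay () ((pointInst I₀ T j).round t) i q.2)
      (List.finRange T) tr).sum = ∑ t, if j t = i then 1 else 0 := by
  exact (sum_zipWith_eq_sum_of_map_snd_eq htr fun t s =>
      utilAt optAllocAlg zeroPay () ((pointInst I₀ T j).round t) i s).trans
    (Finset.sum_congr rfl fun t _ => utilAt_pointInst j t i (j t))

variable [Fintype I₀]

/-- A bound that holds along every trajectory whose states follow `j` bounds the
trajectory expectation. -/
theorem trajExp_pointInst_le (x : (Unit → Bool → ℝ) → Set (Unit → Bool) → (Unit → Bool))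
    (p : (Unit → Bool → ℝ) → Set (Unit → Bool) → Unit → ℝ)
    {T : ℕ} (j : Fin T → I₀) {L : List (I₀ × ℝ) → I₀ → ℝ} (hL : IsLearningAlg L)
    (ts : List (Fin T)) (h : List (I₀ × ℝ)) {F : List (I₀ × I₀) → ℝ} {c : ℝ}
    (hF : ∀ tr : List (I₀ × I₀), tr.map Prod.snd = ts.map j → F tr ≤ c) :
    trajExp x p () (pointInst I₀ T j) L ts h F ≤ c := by
  induction ts generalizing h F with
  | nil => exact hF [] rfl
  | cons t ts ih =>
    have hg : ∀ s, (pointInst I₀ T j).g t s = if s = j t then 1 else 0 := fun _ => rfl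
    simp only [trajExp, hg, mul_ite, mul_one, mul_zero, ite_mul, zero_mul,
      Finset.sum_ite_eq', Finset.mem_univ, if_true]
    calc _ ≤ ∑ i, L h i * c := by
          refine Finset.sum_le_sum fun i _ => mul_le_mul_of_nonneg_left ?_ ((hL h).1 i)
          exact ih _ fun tr htr => hF _ (by simp [htr])
      _ = c := by rw [← Finset.sum_mul, (hL h).2, one_mul]

theorem one_le_expWelOpt_pointInst {T : ℕ} (j : Fin T → I₀) (t : Fin T) :
    1 ≤ expWelOpt () ((pointInst I₀ T j).round t) (j t) := by
  have hg : ∀ s, ((pointInst I₀ T j).round t).g s = if s = j t then 1 else 0 := fun _ => rfl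
  simp only [expWelOpt, hg, ite_mul, one_mul, zero_mul, Finset.sum_ite_eq',
    Finset.mem_univ, if_true]
  have hmem : (1 : ℝ) ∈ (fun a => allocWelfare
      (profOf () ((pointInst I₀ T j).round t) (j t) (j t)) a) '' Set.univ :=
    ⟨fun _ => true, Set.mem_univ _, by
      simp [allocWelfare, profOf, pointInst, DynInstance.round]⟩
  have hle := le_csSup (Set.toFinite _).bddAbove hmem
  have hcost : (((pointInst I₀ T j).round t).inv (j t)).2 = 0 := rfl
  rw [welOptAt, hcost, sub_zero]
  exact hle

variable [Nonempty I₀]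

theorem le_strongDynOptWelfare_pointInst {T : ℕ} (j : Fin T → I₀) :
    (T : ℝ) ≤ strongDynOptWelfare () (pointInst I₀ T j) := by
  calc (T : ℝ) = ∑ _t : Fin T, (1 : ℝ) := by simp
    _ ≤ _ := Finset.sum_le_sum fun t _ => (one_le_expWelOpt_pointInst j t).trans
      (Finset.le_sup' (fun i => expWelOpt () ((pointInst I₀ T j).round t) i)
        (Finset.mem_univ (j t)))

theorem dynRegret_pointInst_le {T : ℕ} (j : Fin T → I₀) {L : List (I₀ × ℝ) → I₀ → ℝ}
    (hL : IsLearningAlg L) :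
    dynRegret optAllocAlg zeroPay () (pointInst I₀ T j) L ≤ T := by
  refine trajExp_pointInst_le _ _ j hL _ _ fun tr htr => ?_
  refine (sub_le_self _ (sum_zipWith_nonneg (fun t q => ?_) _ _)).trans
    (Finset.sup'_le _ _ fun i _ => ?_)
  · refine le_of_le_of_eq ?_ (utilAt_pointInst j t q.1 q.2).symm
    split_ifs <;> norm_num
  · refine (sum_zipWith_utilAt_pointInst j htr i).trans_le ?_
    calc _ ≤ ∑ _t : Fin T, (1 : ℝ) :=
          Finset.sum_le_sum fun t _ => by split_ifs <;> norm_num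
      _ = T := by simp

/-- If the realized states are pairwise distinct, every fixed investment pays off at most
once, so welfare and regret together do not exceed `1`. -/
theorem dynWelfare_add_dynRegret_pointInst_le_one {T : ℕ} {j : Fin T → I₀}
    (hj : Function.Injective j) {L : List (I₀ × ℝ) → I₀ → ℝ} (hL : IsLearningAlg L) :
    dynWelfare optAllocAlg zeroPay () (pointInst I₀ T j) L +
      dynRegret optAllocAlg zeroPay () (pointInst I₀ T j) L ≤ 1 := by
  rw [dynWelfare, dynRegret, ← trajExp_add]
  refine trajExp_pointInst_le _ _ j hL _ _ fun tr htr => ?_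
  have hwel : (fun (t : Fin (pointInst I₀ T j).T) (q : I₀ × I₀) =>
      welAt optAllocAlg () ((pointInst I₀ T j).round t) q.1 q.2) = fun t q =>
        utilAt optAllocAlg zeroPay () ((pointInst I₀ T j).round t) q.1 q.2 :=
    funext₂ fun t q =>
      (welAt_pointInst j t q.1 q.2).trans (utilAt_pointInst j t q.1 q.2).symm
  rw [hwel, add_sub_cancel]
  refine Finset.sup'_le _ _ fun i _ => (sum_zipWith_utilAt_pointInst j htr i).trans_le ?_
  have hcard : #{t | j t = i} ≤ 1 := Finset.card_le_one.2 fun a ha b hb =>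
    hj ((Finset.mem_filter.1 ha).2.trans (Finset.mem_filter.1 hb).2.symm)
  rw [Finset.sum_boole]
  exact_mod_cast hcard

end PointInstance

theorem isLearningAlg_uniform {ix : Type} [Fintype ix] [Nonempty ix] :
    IsLearningAlg fun (_ : List (ix × ℝ)) (_ : ix) => 1 / (Fintype.card ix : ℝ) :=
  fun _ => ⟨fun _ => by positivity, by simp⟩

theorem le_two_mul_sqrt_mul_sqrt_log {n : ℕ} (hn : 2 ≤ n) :
    (n : ℝ) ≤ 2 * Real.sqrt (Real.exp 1 - 1) * Real.sqrt ((n : ℝ) * n * Real.log n) := by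
  have hn' : (2 : ℝ) ≤ n := by exact_mod_cast hn
  have hexp := Real.add_one_le_exp (1 : ℝ)
  have hlog : 1 / 2 ≤ Real.log n := by
    have := Real.log_two_gt_d9
    have := Real.log_le_log two_pos hn'
    linarith
  rw [mul_assoc, ← Real.sqrt_mul (by linarith)]
  have hsq : ((n : ℝ) / 2) ≤
      Real.sqrt ((Real.exp 1 - 1) * ((n : ℝ) * n * Real.log n)) := by
    apply Real.le_sqrt_of_sq_le
    have hmul : 1 / 2 ≤ (Real.exp 1 - 1) * Real.log n := by nlinarith
    nlinarith [mul_le_mul_of_nonneg_left hmul (sq_nonneg (n : ℝ)), sq_nonneg (n : ℝ)]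
  linarith

/-- In the single-investor problem with `|I₀| ≥ 2`, for every
`β > 1/|I₀|` the optimal allocation algorithm is *not* a β-approximation for
strongly dynamic investment: there exist a horizon `T`, an instance `ω̃_j^T` of the
point-mass family, and an online learning algorithm `ℒ` whose regret on every such
instance is at most `2√(e−1)·√(T·|I₀|·ln|I₀|)`, such that
`W̃_x(ω̃_j^T,ℒ) < β·W̃*_dyn(ω̃_j^T) − Reg(ω̃_j^T,ℒ)`. -/
theorem single_investor_not_strongly_dynamic_approx
    {I₀ : Type} [Fintype I₀] [Nonempty I₀] [DecidableEq I₀]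
    (hcard : 2 ≤ Fintype.card I₀)
    (β : ℝ) (hβ : 1 / (Fintype.card I₀ : ℝ) < β) :
    ∃ (T : ℕ) (j : Fin T → I₀) (L : List (I₀ × ℝ) → I₀ → ℝ),
      IsLearningAlg L ∧
      (∀ j' : Fin T → I₀,
        dynRegret optAllocAlg zeroPay () (pointInst I₀ T j') L ≤
          2 * Real.sqrt (Real.exp 1 - 1) *
            Real.sqrt ((T : ℝ) * (Fintype.card I₀ : ℝ) *
              Real.log (Fintype.card I₀ : ℝ))) ∧
      dynWelfare optAllocAlg zeroPay () (pointInst I₀ T j) L <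
        β * strongDynOptWelfare () (pointInst I₀ T j) -
          dynRegret optAllocAlg zeroPay () (pointInst I₀ T j) L := by
  have hn : (0 : ℝ) < Fintype.card I₀ := by exact_mod_cast Fintype.card_pos
  refine ⟨Fintype.card I₀, (Fintype.equivFin I₀).symm, _, isLearningAlg_uniform,
    fun j' => (dynRegret_pointInst_le j' isLearningAlg_uniform).trans
      (le_two_mul_sqrt_mul_sqrt_log hcard), ?_⟩
  have hsum := dynWelfare_add_dynRegret_pointInst_le_one
    (Fintype.equivFin I₀).symm.injective isLearningAlg_uniform
  have hopt := mul_le_mul_of_nonneg_left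
    (le_strongDynOptWelfare_pointInst (Fintype.equivFin I₀).symm)
    ((one_div_pos.2 hn).trans hβ).le
  have hβn := (div_lt_iff₀ hn).1 hβ
  linarith
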